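/- Let E7 = { a ∈ E8 : a_7 = a_8 }. Every polynomial F ∈ ℂ[Y_1, …, Y_8] of total degree at most 2 that vanishes at every point of E7 lies in the ideal ⟨Nm, Y_7 − Y_8⟩; moreover, there exists a polynomial of total degree 3 vanishing at every point of E7 that does not lie in ⟨Nm, Y_7 − Y_8⟩. (Thus the smallest degree of a non-trivial polynomial in I(E7) is three.) -/

import Mathlib

open MvPolynomial

/-- The 240 shortest vectors of the `E₈` root lattice: the vectors `±eᵢ ± eⱼ` (`i < j`)
together with the vectors `(±1/2, …, ±1/2)` with an even number of minus signs. -/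
def E8 : Set (Fin 8 → ℝ) :=
  {v | (∃ i j : Fin 8, i < j ∧ (v i = 1 ∨ v i = -1) ∧ (v j = 1 ∨ v j = -1) ∧
          ∀ l, l ≠ i → l ≠ j → v l = 0) ∨
    ((∀ i, v i = 1 / 2 ∨ v i = -(1 / 2)) ∧
      Even (Finset.univ.filter (fun i => v i = -(1 / 2 : ℝ))).card)}

/-- A real point viewed inside `ℂ^8`. -/
def cx8 : (Fin 8 → ℝ) → (Fin 8 → ℂ) := fun v i => (v i : ℂ)

/-- `Nm = Y₁² + ⋯ + Y₈² − 2`. -/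
noncomputable def Nm8 : MvPolynomial (Fin 8) ℂ :=
  (∑ i : Fin 8, MvPolynomial.X i ^ 2) - MvPolynomial.C 2

/-- The shortest vectors of `E₇`, realized as the vectors of `E8` with equal last two
coordinates. -/
def E7 : Set (Fin 8 → ℝ) := {a ∈ E8 | a 6 = a 7}

/-- The ideal of trivial polynomials for `E7`: the ideal generated by `Nm` and the linear
polynomial `Y₇ − Y₈` vanishing on `E7`. -/
noncomputable def trivE7 : Ideal (MvPolynomial (Fin 8) ℂ) :=
  Ideal.span {Nm8, MvPolynomial.X 6 - MvPolynomial.X 7}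

/-- A polynomial of total degree at most `2` is a constant plus a linear form plus a
quadratic form. -/
theorem MvPolynomial.exists_eq_quadratic {n : ℕ} {R : Type*} [CommRing R]
    (F : MvPolynomial (Fin n) R) (hF : F.totalDegree ≤ 2) :
    ∃ (c : R) (b : Fin n → R) (A : Fin n → Fin n → R),
      F = C c + ∑ i, C (b i) * X i + ∑ i, ∑ j, C (A i j) * (X i * X j) := by
  have key : ∀ s : Finset (Fin n →₀ ℕ), (∀ m ∈ s, m.degree ≤ 2) →
      ∃ (c : R) (b : Fin n → R) (A : Fin n → Fin n → R),
        ∑ m ∈ s, monomial m (coeff m F) =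
          C c + ∑ i, C (b i) * X i + ∑ i, ∑ j, C (A i j) * (X i * X j) := by
    intro s
    induction s using Finset.induction_on with
    | empty => exact fun _ => ⟨0, 0, 0, by simp⟩
    | insert m s hm ih =>
      intro hs
      obtain ⟨c, b, A, h⟩ := ih fun m' hm' => hs m' (Finset.mem_insert_of_mem hm')
      rw [Finset.sum_insert hm, h]
      have hd := hs m (Finset.mem_insert_self m s)
      generalize coeff m F = r
      by_cases h0 : m = 0
      · subst h0
        refine ⟨r + c, b, A, ?_⟩
        rw [C_add, ← C_apply]
        ring
      obtain ⟨i, hi⟩ := Finsupp.ne_iff.mp h0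
      obtain ⟨m, rfl⟩ := exists_add_of_le
        (Finsupp.single_le_iff.mpr (Nat.one_le_iff_ne_zero.mpr hi))
      by_cases h1 : m = 0
      · subst h1
        refine ⟨c, fun k => b k + if k = i then r else 0, A, ?_⟩
        have : ∑ k, C (b k + if k = i then r else 0) * X k =
            ∑ k, C (b k) * X k + C r * (X i : MvPolynomial (Fin n) R) := by
          simp [add_mul, Finset.sum_add_distrib, apply_ite C, ite_mul]
        rw [this, add_zero, C_mul_X_eq_monomial]
        ring
      obtain ⟨j, hj⟩ := Finsupp.ne_iff.mp h1
      obtain ⟨m, rfl⟩ := exists_add_of_le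
        (Finsupp.single_le_iff.mpr (Nat.one_le_iff_ne_zero.mpr hj))
      obtain rfl : m = 0 := by
        rw [← Finsupp.degree_eq_zero_iff]
        simp only [map_add, Finsupp.degree_single] at hd
        omega
      refine ⟨c, b, fun k l => A k l + if k = i then if l = j then r else 0 else 0, ?_⟩
      have : ∑ k, ∑ l, C (A k l + if k = i then if l = j then r else 0 else 0) * (X k * X l) =
          ∑ k, ∑ l, C (A k l) * (X k * X l) +
            C r * (X i * X j : MvPolynomial (Fin n) R) := by
        simp [add_mul, Finset.sum_add_distrib, apply_ite C, ite_mul]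
      rw [this, add_zero, show (monomial (Finsupp.single i 1 + Finsupp.single j 1)) r =
        C r * (X i * X j : MvPolynomial (Fin n) R) by
          rw [X, X, monomial_mul, C_mul_monomial]; simp]
      ring
  obtain ⟨c, b, A, h⟩ := key F.support fun m hm =>
    (le_totalDegree hm).trans hF
  exact ⟨c, b, A, by rw [← h]; exact F.as_sum⟩

/-- The vectors `±eᵢ ± eⱼ` with `i, j` among the first six coordinates lie in `E7`. -/
theorem single_add_single_mem_E7 {i j : Fin 8} (hij : i < j) (hj : j < 6) {s t : ℝ}
    (hs : s = 1 ∨ s = -1) (ht : t = 1 ∨ t = -1) :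
    Pi.single i s + Pi.single j t ∈ E7 := by
  refine ⟨Or.inl ⟨i, j, hij, ?_, ?_, fun l hi hj => by simp [hi, hj]⟩, ?_⟩
  · simpa [hij.ne] using hs
  · simpa [hij.ne'] using ht
  · simp [hj.ne', (hij.trans hj).ne', (hj.trans (by decide : (6 : Fin 8) < 7)).ne',
      ((hij.trans hj).trans (by decide : (6 : Fin 8) < 7)).ne']

/-- The vectors `±(e₇ + e₈)` lie in `E7`. -/
theorem single_six_add_single_seven_mem_E7 {s : ℝ} (hs : s = 1 ∨ s = -1) :
    Pi.single 6 s + Pi.single 7 s ∈ E7 := by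
  refine ⟨Or.inl ⟨6, 7, by decide, ?_, ?_, fun l hi hj => by simp [hi, hj]⟩, ?_⟩
  · simpa using hs
  · simpa using hs
  · simp

/-- The half-integral vector whose negative coordinates are those in `N`. -/
noncomputable def halfVec (N : Finset (Fin 8)) : Fin 8 → ℝ :=
  fun i => if i ∈ N then -(1 / 2) else 1 / 2

theorem halfVec_mem_E7 {N : Finset (Fin 8)} (hN : Even N.card) (h : 6 ∈ N ↔ 7 ∈ N) :
    halfVec N ∈ E7 := by
  refine ⟨Or.inr ⟨fun i => ?_, ?_⟩, by simp [halfVec, h]⟩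
  · unfold halfVec
    split_ifs <;> simp
  · convert hN using 2
    ext i
    by_cases hi : i ∈ N <;> simp [halfVec, hi]
    norm_num

theorem eval_quadratic_single_add_single {n : ℕ} (c : ℂ) (b : Fin n → ℂ)
    (A : Fin n → Fin n → ℂ) {i j : Fin n} (s t : ℂ) :
    eval (Pi.single i s + Pi.single j t)
        (C c + ∑ i, C (b i) * X i + ∑ i, ∑ j, C (A i j) * (X i * X j)) =
      c + (b i * s + b j * t) + (A i i * s ^ 2 + A j j * t ^ 2 + (A i j + A j i) * (s * t)) := by
  simp only [map_add, map_sum, map_mul, eval_C, eval_X, Pi.add_apply, Pi.single_apply]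
  simp only [mul_add, add_mul, Finset.sum_add_distrib, mul_ite, ite_mul, mul_zero, zero_mul,
    Finset.sum_ite_eq', Finset.mem_univ, if_true]
  ring

theorem cx8_single_add_single (i j : Fin 8) (s t : ℝ) :
    cx8 (Pi.single i s + Pi.single j t) = Pi.single i (s : ℂ) + Pi.single j (t : ℂ) := by
  ext k
  simp only [cx8, Pi.add_apply, Pi.single_apply]
  split_ifs <;> simp

theorem mem_trivE7_of_totalDegree_le_two (F : MvPolynomial (Fin 8) ℂ)
    (hF : F.totalDegree ≤ 2) (hv : ∀ a ∈ E7, eval (cx8 a) F = 0) : F ∈ trivE7 := by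
  obtain ⟨c, b, A, rfl⟩ := F.exists_eq_quadratic hF
  have hroot {i j : Fin 8} (hij : i < j) (hj : j < 6) {s t : ℝ}
      (hs : s = 1 ∨ s = -1) (ht : t = 1 ∨ t = -1) :=
    eval_quadratic_single_add_single c b A (i := i) (j := j) s t ▸
      cx8_single_add_single i j s t ▸ hv _ (single_add_single_mem_E7 hij hj hs ht)
  have hlast {s : ℝ} (hs : s = 1 ∨ s = -1) :=
    eval_quadratic_single_add_single c b A (i := 6) (j := 7) s s ▸
      cx8_single_add_single 6 7 s s ▸ hv _ (single_six_add_single_seven_mem_E7 hs)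
  have hpair {i j : Fin 8} (hij : i < j) (hj : j < 6) :
      b i = 0 ∧ b j = 0 ∧ A j i = -A i j ∧ c + A i i + A j j = 0 := by
    have h1 := hroot hij hj (Or.inl rfl) (Or.inl rfl)
    have h2 := hroot hij hj (Or.inl rfl) (Or.inr rfl)
    have h3 := hroot hij hj (Or.inr rfl) (Or.inl rfl)
    have h4 := hroot hij hj (Or.inr rfl) (Or.inr rfl)
    push_cast at h1 h2 h3 h4
    refine ⟨?_, ?_, ?_, ?_⟩
    · linear_combination (h1 + h2 - h3 - h4) / 4
    · linear_combination (h1 - h2 + h3 - h4) / 4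
    · linear_combination (h1 - h2 - h3 + h4) / 4
    · linear_combination (h1 + h2 + h3 + h4) / 4
  have h6 := hlast (Or.inl rfl)
  have h7 := hlast (Or.inr rfl)
  push_cast at h6 h7
  have hb7 : b 7 = -b 6 := by linear_combination (h6 - h7) / 2
  have hA67 : A 6 7 = -c - A 6 6 - A 7 7 - A 7 6 := by linear_combination (h6 + h7) / 2
  obtain ⟨b0, b1, A01, d01⟩ := hpair (i := 0) (j := 1) (by decide) (by decide)
  obtain ⟨-, b2, A02, d02⟩ := hpair (i := 0) (j := 2) (by decide) (by decide)
  obtain ⟨-, b3, A03, d03⟩ := hpair (i := 0) (j := 3) (by decide) (by decide)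
  obtain ⟨-, b4, A04, d04⟩ := hpair (i := 0) (j := 4) (by decide) (by decide)
  obtain ⟨-, b5, A05, d05⟩ := hpair (i := 0) (j := 5) (by decide) (by decide)
  obtain ⟨-, -, A12, d12⟩ := hpair (i := 1) (j := 2) (by decide) (by decide)
  obtain ⟨-, -, A13, -⟩ := hpair (i := 1) (j := 3) (by decide) (by decide)
  obtain ⟨-, -, A14, -⟩ := hpair (i := 1) (j := 4) (by decide) (by decide)
  obtain ⟨-, -, A15, -⟩ := hpair (i := 1) (j := 5) (by decide) (by decide)
  obtain ⟨-, -, A23, -⟩ := hpair (i := 2) (j := 3) (by decide) (by decide)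
  obtain ⟨-, -, A24, -⟩ := hpair (i := 2) (j := 4) (by decide) (by decide)
  obtain ⟨-, -, A25, -⟩ := hpair (i := 2) (j := 5) (by decide) (by decide)
  obtain ⟨-, -, A34, -⟩ := hpair (i := 3) (j := 4) (by decide) (by decide)
  obtain ⟨-, -, A35, -⟩ := hpair (i := 3) (j := 5) (by decide) (by decide)
  obtain ⟨-, -, A45, -⟩ := hpair (i := 4) (j := 5) (by decide) (by decide)
  obtain ⟨α, rfl⟩ : ∃ α, c = -2 * α := ⟨-c / 2, by ring⟩
  have A00 : A 0 0 = α := by linear_combination (d01 + d02 - d12) / 2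
  have A11 : A 1 1 = α := by linear_combination d01 - A00
  have A22 : A 2 2 = α := by linear_combination d02 - A00
  have A33 : A 3 3 = α := by linear_combination d03 - A00
  have A44 : A 4 4 = α := by linear_combination d04 - A00
  have A55 : A 5 5 = α := by linear_combination d05 - A00
  set T : Fin 8 → ℂ := fun i => A i 6 + A 6 i + A i 7 + A 7 i with hT
  have hdecomp : C (-2 * α) + ∑ i, C (b i) * X i + ∑ i, ∑ j, C (A i j) * (X i * X j) =
      C α * Nm8 + (C (b 6) + C (A 6 6 - α) * X 6 - C (A 7 7 - α) * X 7
          - (C (A 0 7 + A 7 0) * X 0 + C (A 1 7 + A 7 1) * X 1 + C (A 2 7 + A 7 2) * X 2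
            + C (A 3 7 + A 7 3) * X 3 + C (A 4 7 + A 7 4) * X 4 + C (A 5 7 + A 7 5) * X 5))
          * (X 6 - X 7)
        + (C (T 0) * X 0 + C (T 1) * X 1 + C (T 2) * X 2 + C (T 3) * X 3 + C (T 4) * X 4
            + C (T 5) * X 5) * X 6 := by
    simp only [Nm8, hT, Fin.sum_univ_eight, b0, b1, b2, b3, b4, b5, hb7, hA67, A00, A11, A22,
      A33, A44, A55, A01, A02, A03, A04, A05, A12, A13, A14, A15, A23, A24, A25, A34, A35, A45,
      map_add, map_sub, map_neg, map_mul, map_zero, map_ofNat]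
    ring
  rw [hdecomp] at hv ⊢
  have hhalf {N : Finset (Fin 8)} (hN : Even N.card) (h : 6 ∈ N ↔ 7 ∈ N) :=
    hv _ (halfVec_mem_E7 hN h)
  have t0 := hhalf (N := ∅) (by decide) (by decide)
  have t1 := hhalf (N := {0, 1}) (by decide) (by decide)
  have t2 := hhalf (N := {0, 2}) (by decide) (by decide)
  have t3 := hhalf (N := {0, 3}) (by decide) (by decide)
  have t4 := hhalf (N := {0, 4}) (by decide) (by decide)
  have t5 := hhalf (N := {0, 5}) (by decide) (by decide)
  have t6 := hhalf (N := {1, 2}) (by decide) (by decide)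
  simp [Nm8, cx8, halfVec, Fin.sum_univ_eight, -mul_eq_zero] at t0 t1 t2 t3 t4 t5 t6
  have T0 : T 0 = 0 := by linear_combination t0 - t1 - t2 + t6
  have T1 : T 1 = 0 := by linear_combination 2 * (t0 - t1) - T0
  have T2 : T 2 = 0 := by linear_combination 2 * (t0 - t2) - T0
  have T3 : T 3 = 0 := by linear_combination 2 * (t0 - t3) - T0
  have T4 : T 4 = 0 := by linear_combination 2 * (t0 - t4) - T0
  have T5 : T 5 = 0 := by linear_combination 2 * (t0 - t5) - T0
  rw [T0, T1, T2, T3, T4, T5]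
  simp only [map_zero, zero_mul, add_zero]
  exact Ideal.mem_span_pair.mpr ⟨_, _, rfl⟩

theorem cubic_vanishes_on_E7 : ∀ a ∈ E7,
    eval (cx8 a) (X 0 * X 1 * X 2 - X 3 * X 4 * X 5 : MvPolynomial (Fin 8) ℂ) = 0 := by
  intro a ha
  suffices h : a 0 * a 1 * a 2 = a 3 * a 4 * a 5 by
    simp only [map_sub, map_mul, eval_X, cx8]
    exact sub_eq_zero.mpr (mod_cast h)
  rcases ha with ⟨⟨i, j, -, -, -, h⟩ | ⟨h, he⟩, h67⟩
  · have hzero {k l m : Fin 8} (hkl : k ≠ l) (hkm : k ≠ m) (hlm : l ≠ m) :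
        a k * a l * a m = 0 := by
      by_contra hne
      simp only [mul_eq_zero, not_or] at hne
      grind
    rw [hzero (by decide) (by decide) (by decide), hzero (by decide) (by decide) (by decide)]
  · have hsq (l : Fin 8) : a l ^ 2 = 1 / 4 := by
      rcases h l with hl | hl <;> rw [hl] <;> norm_num
    have hprod : ∏ l, 2 * a l = 1 := by
      rw [← he.neg_one_pow (α := ℝ), ← Finset.prod_const, Finset.prod_filter]
      refine Finset.prod_congr rfl fun l _ => ?_
      rcases h l with hl | hl <;> rw [hl] <;> norm_num
    rw [Fin.prod_univ_eight, ← h67] at hprod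
    have hpq : (a 0 * a 1 * a 2) * (a 3 * a 4 * a 5) = 1 / 64 := by
      linear_combination hprod / 64 - 4 * (a 0 * a 1 * a 2 * a 3 * a 4 * a 5) * hsq 6
    have hpp : (a 0 * a 1 * a 2) ^ 2 = 1 / 64 := by
      rw [mul_pow, mul_pow, hsq, hsq, hsq]
      norm_num
    linear_combination 64 * (a 3 * a 4 * a 5) * hpp - 64 * (a 0 * a 1 * a 2) * hpq

theorem cubic_notMem_trivE7 :
    (X 0 * X 1 * X 2 - X 3 * X 4 * X 5 : MvPolynomial (Fin 8) ℂ) ∉ trivE7 := by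
  intro h
  have hle : trivE7 ≤ RingHom.ker (eval ![1, 1, 1, Complex.I, 0, 0, 0, 0]) := by
    rw [trivE7, Ideal.span_le]
    rintro p (rfl | rfl)
    · simp [RingHom.mem_ker, Nm8, Fin.sum_univ_eight]
      norm_num
    · simp [RingHom.mem_ker]
  simpa [RingHom.mem_ker] using hle h

theorem cubic_totalDegree :
    (X 0 * X 1 * X 2 - X 3 * X 4 * X 5 : MvPolynomial (Fin 8) ℂ).totalDegree = 3 := by
  refine IsHomogeneous.totalDegree (n := 3) (.sub ?_ ?_) ?_
  · exact ((isHomogeneous_X ℂ 0).mul (isHomogeneous_X ℂ 1)).mul (isHomogeneous_X ℂ 2)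
  · exact ((isHomogeneous_X ℂ 3).mul (isHomogeneous_X ℂ 4)).mul (isHomogeneous_X ℂ 5)
  · intro h
    exact cubic_notMem_trivE7 (h ▸ zero_mem _)

/-- Every `F ∈ ℂ[Y₁,…,Y₈]` of total degree at most `2` vanishing on `E7`
lies in `⟨Nm, Y₇ − Y₈⟩`, and some polynomial of total degree `3` vanishing on `E7` does
not lie in `⟨Nm, Y₇ − Y₈⟩`. -/
theorem statement13 :
    (∀ F : MvPolynomial (Fin 8) ℂ, F.totalDegree ≤ 2 →
      (∀ a ∈ E7, MvPolynomial.eval (cx8 a) F = 0) → F ∈ trivE7) ∧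
    ∃ F : MvPolynomial (Fin 8) ℂ, F.totalDegree = 3 ∧
      (∀ a ∈ E7, MvPolynomial.eval (cx8 a) F = 0) ∧ F ∉ trivE7 :=
  ⟨mem_trivE7_of_totalDegree_le_two, _, cubic_totalDegree, cubic_vanishes_on_E7,
    cubic_notMem_trivE7⟩
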